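/- Let n ≥ 3, let G = Sₙ be the symmetric group on {1,…,n}, and let H be the stabilizer of the letter n (so H is isomorphic to S_{n−1}). Then the Külshammer graph K(G,H) has diameter exactly n − 2: any two irreducible complex characters of H are joined by a path of length at most n − 2 in K(G,H), and there exist two irreducible complex characters of H joined by no path of length at most n − 3. (Equivalently, d_G(H) = 2n − 3, which is the maximal depth of a subgroup of Sₙ.) -/

import Mathlib

noncomputable section

/-- The usual inner product of class functions on a finite group `H`. -/
def charInner (H : Type) (φ ψ : H → ℂ) : ℂ :=
  (Nat.card H : ℂ)⁻¹ * ∑ᶠ h : H, φ h * (starRingEnd ℂ) (ψ h)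

/-- `χ : H → ℂ` is the character of an irreducible complex representation of `H`. -/
def IsIrrChar (H : Type) [Group H] (χ : H → ℂ) : Prop :=
  ∃ V : FDRep ℂ H, CategoryTheory.Simple V ∧ χ = V.character

/-- Restriction of a class function on `G` to a subgroup `H`. -/
def resChar {G : Type} [Group G] (H : Subgroup G) (χ : G → ℂ) : ↥H → ℂ :=
  fun h => χ (h : G)

/-- Two irreducible characters `α, β` of a subgroup `H ≤ G` are linked over `G` if some
irreducible character `χ` of `G` satisfies `⟨χ|_H, α⟩ ≠ 0` and `⟨χ|_H, β⟩ ≠ 0`. -/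
def Linked {G : Type} [Group G] (H : Subgroup G) (α β : ↥H → ℂ) : Prop :=
  ∃ χ : G → ℂ, IsIrrChar G χ ∧
    charInner ↥H (resChar H χ) α ≠ 0 ∧ charInner ↥H (resChar H χ) β ≠ 0

/-- `α` and `β` are joined by a path of length at most `m` in the Külshammer graph
`K(G,H)`: there is a chain of irreducible characters of `H`, of length `k ≤ m`, from `α`
to `β` in which consecutive members are linked over `G`. -/
def LinkedPathLE {G : Type} [Group G] (H : Subgroup G) (m : ℕ) (α β : ↥H → ℂ) : Prop :=
  ∃ k ≤ m, ∃ f : ℕ → (↥H → ℂ), f 0 = α ∧ f k = β ∧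
    (∀ i ≤ k, IsIrrChar ↥H (f i)) ∧ ∀ i < k, Linked H (f i) (f (i + 1))

/-- The conjugate subgroup `g H g⁻¹`. -/
def conjSub {G : Type} [Group G] (g : G) (H : Subgroup G) : Subgroup G :=
  H.map (MulAut.conj g).toMonoidHom

open scoped ComplexOrder in
/-- The character of a complex representation of a finite group satisfies
`χ(g⁻¹) = conj χ(g)`. -/
theorem Representation.character_inv_eq_conj {Γ V : Type} [Group Γ] [Finite Γ] [AddCommGroup V]
    [Module ℂ V] [FiniteDimensional ℂ V] (ρ : Representation ℂ Γ V) (g : Γ) :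
    ρ.character g⁻¹ = (starRingEnd ℂ) (ρ.character g) := by
  classical
  have := Fintype.ofFinite Γ
  let b := Module.finBasis ℂ V
  let M : Γ → Matrix _ _ ℂ := fun g => LinearMap.toMatrix b b (ρ g)
  have hM : ∀ x y, M (x * y) = M x * M y := fun x y => by
    simp only [M, map_mul]
    exact LinearMap.toMatrix_mul b _ _
  have hM1 : M 1 = 1 := by simp [M, Module.End.one_eq_id]
  let P := ∑ x : Γ, (M x).conjTranspose * M x
  have hP : P.PosDef := by
    simp only [P]
    rw [← Finset.add_sum_erase _ _ (Finset.mem_univ (1 : Γ)), hM1]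
    refine Matrix.PosDef.add_posSemidef ?_ ?_
    · simpa using Matrix.PosDef.one
    · exact Matrix.posSemidef_sum _ fun x _ => Matrix.posSemidef_conjTranspose_mul_self _
  have hinv : (M g).conjTranspose * P * M g = P := by
    simp only [P, Finset.mul_sum, Finset.sum_mul]
    refine Fintype.sum_equiv (Equiv.mulRight g) _ _ fun x => ?_
    simp [hM, Matrix.conjTranspose_mul, Matrix.mul_assoc]
  have hgg : M g * M g⁻¹ = 1 := by rw [← hM, mul_inv_cancel, hM1]
  have hPu : IsUnit P.det := (Matrix.isUnit_iff_isUnit_det _).1 hP.isUnit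
  have key : (M g).conjTranspose = P * M g⁻¹ * P⁻¹ := by
    have : (M g).conjTranspose * P = P * M g⁻¹ := by
      rw [← hinv, Matrix.mul_assoc _ (M g), hgg, Matrix.mul_one, hinv]
    rw [← this, Matrix.mul_assoc, Matrix.mul_nonsing_inv _ hPu, Matrix.mul_one]
  have ht : ∀ x, ρ.character x = (M x).trace := fun x => LinearMap.trace_eq_matrix_trace ℂ b _
  rw [ht, ht, starRingEnd_apply, ← Matrix.trace_conjTranspose, key, Matrix.trace_mul_cycle,
    Matrix.nonsing_inv_mul _ hPu, Matrix.one_mul]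

namespace Representation

section FiniteGroup

variable {Γ : Type} [Group Γ] [Finite Γ] {V W : Type} [AddCommGroup V] [Module ℂ V]
  [AddCommGroup W] [Module ℂ W]

instance neZero_card_complex : NeZero (Nat.card Γ : ℂ) :=
  ⟨Nat.cast_ne_zero.2 Nat.card_pos.ne'⟩

theorem charInner_character [FiniteDimensional ℂ V] [FiniteDimensional ℂ W]
    (ρ : Representation ℂ Γ V) (σ : Representation ℂ Γ W) :
    charInner Γ σ.character ρ.character = Module.finrank ℂ (IntertwiningMap ρ σ) := by
  have := Fintype.ofFinite Γ
  have : Invertible (Nat.card Γ : ℂ) := invertibleOfNonzero (NeZero.ne _)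
  rw [← card_inv_mul_sum_char_mul_char_eq_finrank, charInner, finsum_eq_sum_of_fintype]
  simp only [character_inv_eq_conj]

theorem charInner_character_ne_zero_iff [FiniteDimensional ℂ V] [FiniteDimensional ℂ W]
    (ρ : Representation ℂ Γ V) (σ : Representation ℂ Γ W) :
    charInner Γ σ.character ρ.character ≠ 0 ↔ ∃ f : IntertwiningMap ρ σ, f ≠ 0 := by
  have hfin : FiniteDimensional ℂ (IntertwiningMap ρ σ) :=
    Module.Finite.equiv (invariantsEquivIntertwiningMap ρ σ)
  rw [charInner_character, Nat.cast_ne_zero, ← Nat.pos_iff_ne_zero, Module.finrank_pos_iff,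
    nontrivial_iff_exists_ne 0]

theorem IntertwiningMap.exists_leftInverse {ρ : Representation ℂ Γ V} {σ : Representation ℂ Γ W}
    (i : IntertwiningMap ρ σ) (hi : Function.Injective i) :
    ∃ p : IntertwiningMap σ ρ, ∀ v, p (i v) = v := by
  obtain ⟨p, hp⟩ := MonoidAlgebra.exists_leftInverse_of_injective
    (IntertwiningMap.equivLinearMapAsModule ρ σ i) (LinearMap.ker_eq_bot.2 hi)
  exact ⟨(IntertwiningMap.equivLinearMapAsModule σ ρ).symm p, fun v => LinearMap.congr_fun hp v⟩

/-- The inclusion of a subrepresentation. -/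
def _root_.Subrepresentation.inclusion {σ : Representation ℂ Γ W} (S : Subrepresentation σ) :
    IntertwiningMap S.toRepresentation σ :=
  ⟨S.toSubmodule.subtype, fun _ => rfl⟩

theorem isIrreducible_of_finrank_intertwiningMap (ρ : Representation ℂ Γ V)
    (h : Module.finrank ℂ (IntertwiningMap ρ ρ) = 1) : ρ.IsIrreducible := by
  obtain ⟨e, he, hspan⟩ := finrank_eq_one_iff'.1 h
  obtain ⟨c₀, hc₀⟩ := hspan (IntertwiningMap.id ρ)
  have hscalar : ∀ f : IntertwiningMap ρ ρ, ∃ c : ℂ, ∀ v, f v = c • v := fun f => by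
    obtain ⟨d, hd⟩ := hspan f
    have hid : ∀ v, v = c₀ • e v := fun v => congrArg (fun f : IntertwiningMap ρ ρ => f v) hc₀.symm
    have hc₀' : c₀ ≠ 0 := by
      rintro rfl
      refine he (IntertwiningMap.ext (LinearMap.ext fun v => ?_))
      have hv : v = 0 := by simpa using hid v
      simp [hv]
    refine ⟨d * c₀⁻¹, fun v => ?_⟩
    conv_rhs => rw [hid v]
    rw [smul_smul, mul_assoc, inv_mul_cancel₀ hc₀', mul_one, ← hd]
    rfl
  have hnt : Nontrivial V := by
    by_contra hV
    rw [not_nontrivial_iff_subsingleton] at hV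
    exact he (IntertwiningMap.ext (LinearMap.ext fun v => Subsingleton.elim _ _))
  have : Nontrivial (Subrepresentation ρ) := by
    refine ⟨⟨⊥, ⊤, fun hbt => ?_⟩⟩
    obtain ⟨v, hv⟩ := exists_ne (0 : V)
    have : v ∈ (⊤ : Subrepresentation ρ).toSubmodule := Submodule.mem_top
    rw [← hbt] at this
    exact hv ((Submodule.mem_bot ℂ).1 this)
  refine ⟨fun S => or_iff_not_imp_left.2 fun hS => ?_⟩
  obtain ⟨p, hp⟩ := S.inclusion.exists_leftInverse S.toSubmodule.injective_subtype
  obtain ⟨c, hc⟩ := hscalar (S.inclusion.comp p)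
  have hSne : S.toSubmodule ≠ ⊥ := fun h0 => hS (Subrepresentation.toSubmodule_injective h0)
  obtain ⟨u, huS, hu⟩ := (Submodule.ne_bot_iff _).1 hSne
  have hc1 : c = 1 := by
    have h1 : S.inclusion (p u) = c • u := hc u
    have h2 : p u = ⟨u, huS⟩ := hp ⟨u, huS⟩
    rw [h2] at h1
    have h3 : (1 : ℂ) • u = c • u := by rw [one_smul]; exact h1
    exact (smul_left_injective ℂ hu h3).symm
  refine Subrepresentation.toSubmodule_injective (eq_top_iff.2 fun v _ => ?_)
  have h1 : S.inclusion (p v) = c • v := hc v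
  rw [hc1, one_smul] at h1
  rw [← h1]
  exact (p v).2

theorem _root_.isIrrChar_iff (χ : Γ → ℂ) :
    IsIrrChar Γ χ ↔ ∃ (V : Type) (_ : AddCommGroup V) (_ : Module ℂ V)
      (_ : FiniteDimensional ℂ V) (ρ : Representation ℂ Γ V), ρ.IsIrreducible ∧
        χ = ρ.character := by
  have := Fintype.ofFinite Γ
  have : Invertible (Nat.card Γ : ℂ) := invertibleOfNonzero (NeZero.ne _)
  constructor
  · rintro ⟨V, hV, rfl⟩
    refine ⟨V, inferInstance, inferInstance, inferInstance, V.ρ, ?_, rfl⟩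
    apply isIrreducible_of_finrank_intertwiningMap
    have h := (FDRep.simple_iff_char_is_norm_one V).1 hV
    have h2 := card_inv_mul_sum_char_mul_char_eq_finrank (k := ℂ) (G := Γ) V.ρ V.ρ
    have h3 : Representation.character V.ρ = V.character := rfl
    rw [h3, h, inv_mul_cancel₀ (NeZero.ne _)] at h2
    exact_mod_cast h2.symm
  · rintro ⟨V, _, _, _, ρ, hρ, rfl⟩
    refine ⟨FDRep.of ρ, ?_, rfl⟩
    rw [FDRep.simple_iff_char_is_norm_one]
    have h2 := card_inv_mul_sum_char_mul_char_eq_finrank (k := ℂ) (G := Γ) ρ ρ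
    rw [IsIrreducible.finrank_intertwiningMap_self, inv_mul_eq_iff_eq_mul₀ (NeZero.ne _)] at h2
    rw [Nat.cast_one, mul_one] at h2
    exact h2

omit [Finite Γ] in
theorem _root_.Subrepresentation.isIrreducible_of_isAtom {σ : Representation ℂ Γ W}
    {S : Subrepresentation σ} (hS : IsAtom S) : S.toRepresentation.IsIrreducible := by
  have hSne : S.toSubmodule ≠ ⊥ := fun h0 =>
    hS.1 (Subrepresentation.toSubmodule_injective h0)
  obtain ⟨u, huS, hu⟩ := (Submodule.ne_bot_iff _).1 hSne
  have : Nontrivial (Subrepresentation S.toRepresentation) := by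
    refine ⟨⟨⊥, ⊤, fun hbt => ?_⟩⟩
    have : (⟨u, huS⟩ : S.toSubmodule) ∈
        (⊤ : Subrepresentation S.toRepresentation).toSubmodule := Submodule.mem_top
    rw [← hbt] at this
    exact hu (congrArg Subtype.val ((Submodule.mem_bot ℂ).1 this))
  refine ⟨fun T => ?_⟩
  let T' : Subrepresentation σ := ⟨T.toSubmodule.map S.toSubmodule.subtype, by
    rintro g _ ⟨v, hv, rfl⟩
    exact ⟨S.toRepresentation g v, T.apply_mem_toSubmodule g hv, rfl⟩⟩
  have hT' : T' ≤ S := by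
    rintro _ ⟨v, -, rfl⟩
    exact v.2
  rcases hS.le_iff.1 hT' with h | h
  · refine Or.inl (Subrepresentation.toSubmodule_injective (eq_bot_iff.2 fun v hv => ?_))
    have : (v : W) ∈ T'.toSubmodule := ⟨v, hv, rfl⟩
    rw [h] at this
    exact (Submodule.mem_bot ℂ).2 (Subtype.ext ((Submodule.mem_bot ℂ).1 this))
  · refine Or.inr (Subrepresentation.toSubmodule_injective (eq_top_iff.2 fun v _ => ?_))
    have hv : (v : W) ∈ T'.toSubmodule := by rw [h]; exact v.2
    obtain ⟨w, hw, hwv⟩ := hv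
    rwa [← Subtype.ext hwv]

theorem _root_.Subrepresentation.exists_isIrreducible_le {σ : Representation ℂ Γ W}
    {S : Subrepresentation σ} (hS : S ≠ ⊥) :
    ∃ T ≤ S, T.toRepresentation.IsIrreducible := by
  have : IsAtomic (Subrepresentation σ) :=
    (Subrepresentation.subrepresentationSubmoduleOrderIso (ρ := σ)).isAtomic_iff.2 inferInstance
  obtain ⟨T, hT, hTS⟩ := (eq_bot_or_exists_atom_le S).resolve_left hS
  exact ⟨T, hTS, Subrepresentation.isIrreducible_of_isAtom hT⟩

omit [Finite Γ] in
theorem _root_.Subrepresentation.exists_ne_zero_of_isIrreducible {σ : Representation ℂ Γ W}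
    {S : Subrepresentation σ} (hS : S.toRepresentation.IsIrreducible) :
    ∃ v ∈ S.toSubmodule, v ≠ 0 := by
  by_contra! h
  refine bot_ne_top (α := Subrepresentation S.toRepresentation)
    (Subrepresentation.toSubmodule_injective (eq_top_iff.2 fun v _ => ?_))
  exact (Submodule.mem_bot ℂ).2 (Subtype.ext (h v v.2))

/-- The target of a nonzero intertwining map has an irreducible subrepresentation which is also
a quotient of the source. -/
theorem exists_irreducible_of_intertwiningMap_ne_zero
    {ρ : Representation ℂ Γ V} {σ : Representation ℂ Γ W} (f : IntertwiningMap ρ σ) (hf : f ≠ 0) :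
    ∃ S : Subrepresentation σ, S.toRepresentation.IsIrreducible ∧ S.inclusion ≠ 0 ∧
      ∃ g : IntertwiningMap ρ S.toRepresentation, g ≠ 0 := by
  have hrange : f.range ≠ ⊥ := fun h => hf (IntertwiningMap.ext (LinearMap.ext fun v => by
    have : f v ∈ f.range.toSubmodule := ⟨v, rfl⟩
    rw [h] at this
    exact (Submodule.mem_bot ℂ).1 this))
  obtain ⟨S, hS, hirr⟩ := Subrepresentation.exists_isIrreducible_le hrange
  obtain ⟨u, huS, hu⟩ := Subrepresentation.exists_ne_zero_of_isIrreducible hirr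
  obtain ⟨p, hp⟩ := S.inclusion.exists_leftInverse S.toSubmodule.injective_subtype
  obtain ⟨v, hv⟩ := hS huS
  refine ⟨S, hirr, fun h0 => hu ?_, p.comp f, fun h0 => hu ?_⟩
  · exact congrArg (fun f : IntertwiningMap _ _ => f ⟨u, huS⟩) h0
  · have h1 : p (f v) = 0 := congrArg (fun f : IntertwiningMap _ _ => f v) h0
    have h2 : f v = u := hv
    have h3 : p u = ⟨u, huS⟩ := hp ⟨u, huS⟩
    rw [h2, h3] at h1
    exact congrArg Subtype.val h1

end FiniteGroup
end Representation

/-- `φ` is the character of a finite-dimensional complex representation of `Γ`. -/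
def IsRepChar (Γ : Type) [Group Γ] (φ : Γ → ℂ) : Prop :=
  ∃ (V : Type) (_ : AddCommGroup V) (_ : Module ℂ V) (_ : FiniteDimensional ℂ V)
    (ρ : Representation ℂ Γ V), φ = ρ.character

section RepChar

variable {Γ Δ : Type} [Group Γ] [Group Δ] {φ ψ : Γ → ℂ}

theorem IsIrrChar.isRepChar [Finite Γ] (h : IsIrrChar Γ φ) : IsRepChar Γ φ := by
  obtain ⟨V, _, _, _, ρ, -, rfl⟩ := (isIrrChar_iff φ).1 h
  exact ⟨V, _, _, ‹_›, ρ, rfl⟩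

theorem IsRepChar.mul (hφ : IsRepChar Γ φ) (hψ : IsRepChar Γ ψ) : IsRepChar Γ (φ * ψ) := by
  obtain ⟨V, _, _, _, ρ, rfl⟩ := hφ
  obtain ⟨W, _, _, _, σ, rfl⟩ := hψ
  exact ⟨_, _, _, inferInstance, ρ.tprod σ, (ρ.char_tensor σ).symm⟩

theorem IsRepChar.comp (hφ : IsRepChar Γ φ) (f : Δ →* Γ) : IsRepChar Δ (φ ∘ f) := by
  obtain ⟨V, _, _, _, ρ, rfl⟩ := hφ
  exact ⟨V, _, _, ‹_›, MonoidHom.comp ρ f, rfl⟩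

theorem IsRepChar.restrict (hφ : IsRepChar Γ φ) (K : Subgroup Γ) : IsRepChar K (resChar K φ) :=
  hφ.comp K.subtype

theorem IsRepChar.exists_charInner_eq_natCast [Finite Γ] (hφ : IsRepChar Γ φ)
    (hψ : IsRepChar Γ ψ) : ∃ m : ℕ, charInner Γ φ ψ = m := by
  obtain ⟨V, _, _, _, ρ, rfl⟩ := hφ
  obtain ⟨W, _, _, _, σ, rfl⟩ := hψ
  exact ⟨_, Representation.charInner_character σ ρ⟩

omit [Group Γ] in
theorem charInner_conj_symm [Finite Γ] (φ ψ : Γ → ℂ) :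
    (starRingEnd ℂ) (charInner Γ φ ψ) = charInner Γ ψ φ := by
  have := Fintype.ofFinite Γ
  simp only [charInner, finsum_eq_sum_of_fintype, map_mul, map_sum, map_inv₀, Complex.conj_conj,
    map_natCast, mul_comm]

omit [Group Γ] in
theorem charInner_ne_zero_symm [Finite Γ] (h : charInner Γ φ ψ ≠ 0) : charInner Γ ψ φ ≠ 0 := by
  rw [← charInner_conj_symm]
  simpa using h

/-- Two non-orthogonal characters have a common irreducible constituent. -/
theorem IsRepChar.exists_isIrrChar [Finite Γ] (hφ : IsRepChar Γ φ) (hψ : IsRepChar Γ ψ)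
    (h : charInner Γ φ ψ ≠ 0) :
    ∃ γ, IsIrrChar Γ γ ∧ charInner Γ φ γ ≠ 0 ∧ charInner Γ ψ γ ≠ 0 := by
  obtain ⟨V, _, _, _, σ, rfl⟩ := hφ
  obtain ⟨W, _, _, _, ρ, rfl⟩ := hψ
  obtain ⟨f, hf⟩ := (Representation.charInner_character_ne_zero_iff ρ σ).1 h
  obtain ⟨S, hS, hi, g, hg⟩ := Representation.exists_irreducible_of_intertwiningMap_ne_zero f hf
  refine ⟨S.toRepresentation.character, (isIrrChar_iff _).2
    ⟨_, _, _, inferInstance, S.toRepresentation, hS, rfl⟩, ?_, ?_⟩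
  · exact (Representation.charInner_character_ne_zero_iff _ _).2 ⟨_, hi⟩
  · exact charInner_ne_zero_symm ((Representation.charInner_character_ne_zero_iff _ _).2 ⟨g, hg⟩)

/-- If `χ` is an irreducible constituent of `φ`, and the restrictions of `χ` and `ψ` along a
homomorphism are not orthogonal, then neither are the restrictions of `φ` and `ψ`. -/
theorem IsRepChar.charInner_comp_ne_zero [Finite Γ] [Finite Δ] (hφ : IsRepChar Γ φ)
    {χ : Γ → ℂ} (hχ : IsIrrChar Γ χ) (h : charInner Γ φ χ ≠ 0) (f : Δ →* Γ) {ψ : Δ → ℂ}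
    (hψ : IsRepChar Δ ψ) (h' : charInner Δ (χ ∘ f) ψ ≠ 0) : charInner Δ (φ ∘ f) ψ ≠ 0 := by
  obtain ⟨V, _, _, _, σ, rfl⟩ := hφ
  obtain ⟨W, _, _, _, ρ, rfl⟩ := hψ
  obtain ⟨U, _, _, _, τ, hτ, rfl⟩ := (isIrrChar_iff χ).1 hχ
  obtain ⟨i, hi⟩ := (Representation.charInner_character_ne_zero_iff τ σ).1 h
  have hinj := (Representation.IsIrreducible.injective_or_eq_zero i).resolve_right hi
  obtain ⟨g, hg⟩ := (Representation.charInner_character_ne_zero_iff ρ (MonoidHom.comp τ f)).1 h'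
  let i' : Representation.IntertwiningMap (MonoidHom.comp τ f) (MonoidHom.comp σ f) :=
    ⟨i.toLinearMap, fun d => i.isIntertwining' (f d)⟩
  refine (Representation.charInner_character_ne_zero_iff ρ (MonoidHom.comp σ f)).2
    ⟨i'.comp g, fun h0 => hg ?_⟩
  refine Representation.IntertwiningMap.ext (LinearMap.ext fun v => hinj ?_)
  have h1 : i (g v) = 0 :=
    congrArg (fun f : Representation.IntertwiningMap _ _ => f v) h0
  exact h1.trans (map_zero i).symm

theorem IsRepChar.charInner_ne_zero_of_common [Finite Γ] (hφ : IsRepChar Γ φ)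
    (hψ : IsRepChar Γ ψ) {χ : Γ → ℂ} (hχ : IsIrrChar Γ χ) (h : charInner Γ φ χ ≠ 0)
    (hψχ : charInner Γ ψ χ ≠ 0) : charInner Γ φ ψ ≠ 0 :=
  hφ.charInner_comp_ne_zero hχ h (MonoidHom.id Γ) hψ (charInner_ne_zero_symm hψχ)

/-- Non-orthogonality of restrictions along `f` only depends on the image of `f`. -/
theorem IsRepChar.charInner_ne_zero_of_comp_surjective [Finite Γ] [Finite Δ] (hφ : IsRepChar Γ φ)
    (hψ : IsRepChar Γ ψ) (f : Δ →* Γ) (hf : Function.Surjective f)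
    (h : charInner Δ (φ ∘ f) (ψ ∘ f) ≠ 0) : charInner Γ φ ψ ≠ 0 := by
  obtain ⟨V, _, _, _, σ, rfl⟩ := hφ
  obtain ⟨W, _, _, _, ρ, rfl⟩ := hψ
  obtain ⟨g, hg⟩ := (Representation.charInner_character_ne_zero_iff
    (MonoidHom.comp ρ f) (MonoidHom.comp σ f)).1 h
  refine (Representation.charInner_character_ne_zero_iff ρ σ).2
    ⟨⟨g.toLinearMap, fun x => ?_⟩, fun h0 => hg ?_⟩
  · obtain ⟨d, rfl⟩ := hf x
    exact g.isIntertwining' d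
  · have h1 : g.toLinearMap = 0 := congrArg
      (fun f : Representation.IntertwiningMap ρ σ => f.toLinearMap) h0
    exact Representation.IntertwiningMap.ext h1

/-- A linear character is an irreducible character. -/
theorem isIrrChar_monoidHom [Finite Γ] (l : Γ →* ℂ) : IsIrrChar Γ l := by
  have := Fintype.ofFinite Γ
  let ρ : Representation ℂ Γ ℂ := (Algebra.lmul ℂ ℂ : ℂ →* Module.End ℂ ℂ).comp l
  have hρ : ρ.character = l := by
    ext g
    change LinearMap.trace ℂ ℂ (Algebra.lmul ℂ ℂ (l g)) = l g
    rw [LinearMap.trace_eq_matrix_trace ℂ (Module.Basis.singleton Unit ℂ)]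
    simp [Matrix.trace, LinearMap.toMatrix_apply]
  refine (isIrrChar_iff _).2 ⟨ℂ, inferInstance, inferInstance, inferInstance, ρ, ?_, hρ.symm⟩
  apply Representation.isIrreducible_of_finrank_intertwiningMap
  have h := Representation.charInner_character ρ ρ
  have hterm : ∀ g, l g * (starRingEnd ℂ) (l g) = 1 := fun g => by
    rw [← hρ, ← Representation.character_inv_eq_conj, hρ, ← map_mul, mul_inv_cancel, map_one]
  simp only [charInner, hρ, hterm, finsum_eq_sum_of_fintype, Finset.sum_const, Finset.card_univ,
    nsmul_eq_mul, mul_one] at h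
  rw [← Nat.card_eq_fintype_card, inv_mul_cancel₀ (NeZero.ne _)] at h
  exact_mod_cast h.symm

end RepChar

section PermChar

variable (Γ : Type) [Group Γ] (X : Type) [MulAction Γ X]

/-- The character of the permutation representation of `Γ` on the set `X`. -/
def permChar (g : Γ) : ℂ := Nat.card (MulAction.fixedBy X g)

theorem isRepChar_permChar [Finite X] : IsRepChar Γ (permChar Γ X) := by
  classical
  have := Fintype.ofFinite X
  let ρ : Representation ℂ Γ (X → ℂ) :=
    { toFun := fun g => LinearMap.funLeft ℂ ℂ fun x : X => g⁻¹ • x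
      map_one' := by ext; simp [LinearMap.funLeft]
      map_mul' := fun g h => by
        refine LinearMap.ext fun v => funext fun x => ?_
        simp [LinearMap.funLeft_apply, mul_smul] }
  refine ⟨X → ℂ, inferInstance, inferInstance, inferInstance, ρ, funext fun g => ?_⟩
  change _ = LinearMap.trace ℂ (X → ℂ) (LinearMap.funLeft ℂ ℂ fun x : X => g⁻¹ • x)
  rw [LinearMap.trace_eq_matrix_trace ℂ (Pi.basisFun ℂ X), permChar, Nat.card_eq_fintype_card,
    Fintype.card_subtype, Matrix.trace, Finset.card_filter, Nat.cast_sum]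
  refine Finset.sum_congr rfl fun x _ => ?_
  simp only [MulAction.mem_fixedBy, Matrix.diag_apply, LinearMap.toMatrix_apply,
    Pi.basisFun_apply, Pi.basisFun_repr, LinearMap.funLeft_apply, Pi.single_apply,
    inv_smul_eq_iff, eq_comm (a := x), Nat.cast_ite, Nat.cast_one, Nat.cast_zero]

/-- The permutation character on tuples is a power of the permutation character. -/
theorem permChar_fin_fun [Finite X] (k : ℕ) :
    permChar Γ (Fin k → X) = permChar Γ X ^ k := by
  funext g
  have e : MulAction.fixedBy (Fin k → X) g ≃ (Fin k → MulAction.fixedBy X g) :=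
    { toFun := fun t i => ⟨t.1 i, congrFun t.2 i⟩
      invFun := fun t => ⟨fun i => (t i).1, funext fun i => (t i).2⟩
      left_inv := fun _ => rfl
      right_inv := fun _ => rfl }
  simp [permChar, Nat.card_congr e, Nat.card_fun]

variable {Γ X}

/-- Multiplying by a permutation character amounts to restricting to point stabilizers. -/
theorem IsRepChar.charInner_mul_permChar_ne_zero_iff [Finite Γ] [Finite X] {φ ψ : Γ → ℂ}
    (hφ : IsRepChar Γ φ) (hψ : IsRepChar Γ ψ) :
    charInner Γ (φ * permChar Γ X) ψ ≠ 0 ↔ ∃ x : X,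
      charInner (MulAction.stabilizer Γ x) (resChar _ φ) (resChar _ ψ) ≠ 0 := by
  classical
  have := Fintype.ofFinite X
  have := Fintype.ofFinite Γ
  choose m hm using fun x : X => (hφ.restrict (MulAction.stabilizer Γ x)).exists_charInner_eq_natCast
    (hψ.restrict (MulAction.stabilizer Γ x))
  have hstab : ∀ x : X, ∑ g : Γ, (if g • x = x then φ g * (starRingEnd ℂ) (ψ g) else 0) =
      Nat.card (MulAction.stabilizer Γ x) * (m x : ℂ) := fun x => by
    rw [← hm, charInner, finsum_eq_sum_of_fintype, mul_inv_cancel_left₀ (NeZero.ne _),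
      ← Finset.sum_filter]
    exact (Finset.sum_subtype _ (by simp [MulAction.mem_stabilizer_iff])
      fun g => φ g * (starRingEnd ℂ) (ψ g))
  have key : charInner Γ (φ * permChar Γ X) ψ = (Nat.card Γ : ℂ)⁻¹ *
      ((∑ x : X, Nat.card (MulAction.stabilizer Γ x) * m x : ℕ) : ℂ) := by
    rw [charInner, finsum_eq_sum_of_fintype]
    push_cast
    simp_rw [← hstab]
    rw [Finset.sum_comm]
    congr 1
    refine Finset.sum_congr rfl fun g _ => ?_
    rw [← Finset.sum_filter, Finset.sum_const, Pi.mul_apply, permChar, Nat.card_eq_fintype_card,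
      Fintype.card_subtype, nsmul_eq_mul]
    simp only [MulAction.mem_fixedBy]
    ring
  rw [key]
  simp only [hm, ne_eq, mul_eq_zero, inv_eq_zero, Nat.cast_eq_zero, Finset.sum_eq_zero_iff,
    Finset.mem_univ, true_implies, Nat.card_pos.ne', false_or, not_forall]

/-- For a transitive action it suffices to look at a single point stabilizer. -/
theorem IsRepChar.charInner_mul_permChar_ne_zero_iff_of_isPretransitive [Finite Γ] [Finite X]
    [MulAction.IsPretransitive Γ X] {φ ψ : Γ → ℂ} (hφ : IsRepChar Γ φ) (hψ : IsRepChar Γ ψ)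
    (x : X) : charInner Γ (φ * permChar Γ X) ψ ≠ 0 ↔
      charInner (MulAction.stabilizer Γ x) (resChar _ φ) (resChar _ ψ) ≠ 0 := by
  rw [hφ.charInner_mul_permChar_ne_zero_iff hψ]
  refine ⟨?_, fun h => ⟨x, h⟩⟩
  rintro ⟨y, hy⟩
  obtain ⟨g, rfl⟩ := MulAction.exists_smul_eq Γ x y
  let e := MulAction.stabilizerEquivStabilizer (G := Γ) (a := x) (b := g • x) (g := g) rfl
  refine (hφ.restrict _).charInner_ne_zero_of_comp_surjective (hψ.restrict _)
    e.symm.toMonoidHom e.symm.surjective ?_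
  have hclass : ∀ {φ : Γ → ℂ}, IsRepChar Γ φ →
      resChar (MulAction.stabilizer Γ x) φ ∘ e.symm.toMonoidHom = resChar _ φ := by
    rintro _ ⟨V, _, _, _, ρ, rfl⟩
    funext s
    obtain ⟨s, rfl⟩ := e.surjective s
    have he : (e s : Γ) = g * s * g⁻¹ := MulAction.stabilizerEquivStabilizer_apply ..
    change ρ.character (e.symm (e s)) = ρ.character (e s)
    rw [e.symm_apply_apply, he, ρ.char_conj]
  rwa [hclass hφ, hclass hψ]

end PermChar

section Coinduction

variable {Γ : Type} [Group Γ] [Finite Γ] {V : Type} [AddCommGroup V] [Module ℂ V]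

/-- If `c` acts nontrivially on a representation, it does so on an irreducible subrepresentation. -/
theorem Representation.exists_isIrreducible_apply_ne_one (σ : Representation ℂ Γ V) {c : Γ}
    (hc : σ c ≠ 1) :
    ∃ S : Subrepresentation σ, S.toRepresentation.IsIrreducible ∧ S.toRepresentation c ≠ 1 := by
  let F : Subrepresentation σ :=
    { toSubmodule := ⨅ g : Γ, LinearMap.ker (σ (g * c * g⁻¹) - 1)
      apply_mem_toSubmodule := fun x v hv => by
        simp only [Submodule.mem_iInf, LinearMap.mem_ker, LinearMap.sub_apply,
          Module.End.one_apply, sub_eq_zero] at hv ⊢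
        intro g
        have h := congrArg (σ x) (hv (x⁻¹ * g))
        rw [← Module.End.mul_apply, ← map_mul] at h ⊢
        rw [← h]
        congr 2
        group }
  have hF : ∀ v, v ∈ F ↔ ∀ g : Γ, σ (g * c * g⁻¹) v = v := fun v => by
    change v ∈ F.toSubmodule ↔ _
    simp [F, Submodule.mem_iInf, sub_eq_zero]
  obtain ⟨F', hF'⟩ := exists_isCompl F
  have hne : F' ≠ ⊥ := by
    rintro rfl
    refine hc (LinearMap.ext fun v => ?_)
    have hv : v ∈ (⊤ : Subrepresentation σ).toSubmodule := Submodule.mem_top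
    rw [← eq_top_of_isCompl_bot hF'] at hv
    simpa using (hF v).1 hv 1
  obtain ⟨S, hS, hirr⟩ := Subrepresentation.exists_isIrreducible_le hne
  refine ⟨S, hirr, fun h1 => ?_⟩
  obtain ⟨v, hv, hv0⟩ := Subrepresentation.exists_ne_zero_of_isIrreducible hirr
  have hcS : ∀ w ∈ S.toSubmodule, σ c w = w := fun w hw =>
    congrArg Subtype.val (LinearMap.congr_fun h1 ⟨w, hw⟩)
  have hvF : v ∈ F := (hF v).2 fun g => by
    rw [map_mul, map_mul, Module.End.mul_apply, Module.End.mul_apply,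
      hcS _ (S.apply_mem_toSubmodule _ hv), ← Module.End.mul_apply, ← map_mul]
    simp
  have hbot : v ∈ (⊥ : Subrepresentation σ).toSubmodule := by
    rw [← hF'.inf_eq_bot]
    exact ⟨hvF, hS hv⟩
  exact hv0 ((Submodule.mem_bot ℂ).1 hbot)

omit [Finite Γ] in
/-- An element outside a subgroup acts nontrivially on every representation coinduced from it. -/
theorem Representation.coind_subtype_apply_ne_one [Nontrivial V] {K : Subgroup Γ}
    (τ : Representation ℂ K V) {c : Γ} (hc : c ∉ K) : coind K.subtype τ c ≠ 1 := by
  classical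
  obtain ⟨v, hv⟩ := exists_ne (0 : V)
  let f : coindV K.subtype τ :=
    ⟨fun x => if hx : x ∈ K then τ ⟨x, hx⟩ v else 0, fun k x => by
      dsimp only
      by_cases hx : x ∈ K
      · have hkx : K.subtype k * x ∈ K := K.mul_mem k.2 hx
        rw [dif_pos hx, dif_pos hkx, ← Module.End.mul_apply, ← map_mul]
        rfl
      · have hkx : K.subtype k * x ∉ K := fun h => hx ((K.mul_mem_cancel_left k.2).1 h)
        rw [dif_neg hx, dif_neg hkx, map_zero]⟩
  intro h
  have h1 : f.1 (1 * c) = f.1 1 := congrArg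
    (fun u : coindV K.subtype τ => u.1 1) (LinearMap.congr_fun h f)
  have h2 : τ ⟨1, K.one_mem⟩ v = v := LinearMap.congr_fun (map_one τ) v
  simp only [f, one_mul, dif_neg hc, dif_pos K.one_mem, h2] at h1
  exact hv h1.symm

/-- A representation of `Γ` with a `K`-equivariant map `e` to `τ` whose kernel contains no nonzero
subrepresentation has irreducible constituents lying above `τ`. -/
theorem Representation.exists_isIrreducible_above [FiniteDimensional ℂ V] {K : Subgroup Γ}
    (τ : Representation ℂ K V) {W : Type} [AddCommGroup W] [Module ℂ W] [FiniteDimensional ℂ W]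
    (σ : Representation ℂ Γ W) (e : W →ₗ[ℂ] V) (he : ∀ (k : K) w, e (σ k w) = τ k (e w))
    (he0 : ∀ w, (∀ x, e (σ x w) = 0) → w = 0) {c : Γ} (hc : σ c ≠ 1) :
    ∃ (U : Type) (_ : AddCommGroup U) (_ : Module ℂ U) (_ : FiniteDimensional ℂ U)
      (ρ : Representation ℂ Γ U), ρ.IsIrreducible ∧ ρ c ≠ 1 ∧
        charInner K (resChar K ρ.character) τ.character ≠ 0 := by
  obtain ⟨S, hS, hSc⟩ := σ.exists_isIrreducible_apply_ne_one hc
  refine ⟨S.toSubmodule, inferInstance, inferInstance, inferInstance, S.toRepresentation, hS, hSc,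
    charInner_ne_zero_symm ((charInner_character_ne_zero_iff
      (MonoidHom.comp S.toRepresentation K.subtype) τ).2
      ⟨⟨e ∘ₗ S.toSubmodule.subtype, fun k => LinearMap.ext fun w => he k w⟩, fun h0 => ?_⟩)⟩
  obtain ⟨u, hu, hu0⟩ := Subrepresentation.exists_ne_zero_of_isIrreducible hS
  exact hu0 (he0 u fun x => congrArg (fun f : IntertwiningMap _ _ =>
    f ⟨_, S.apply_mem_toSubmodule x hu⟩) h0)

/-- Every irreducible character of a subgroup `K` lies below an irreducible character of the
whole group with a given element `c ∉ K` outside its kernel. -/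
theorem IsIrrChar.exists_isIrreducible_apply_ne_one {K : Subgroup Γ} {α : K → ℂ}
    (hα : IsIrrChar K α) {c : Γ} (hc : c ∉ K) :
    ∃ (U : Type) (_ : AddCommGroup U) (_ : Module ℂ U) (_ : FiniteDimensional ℂ U)
      (ρ : Representation ℂ Γ U), ρ.IsIrreducible ∧ ρ c ≠ 1 ∧
        charInner K (resChar K ρ.character) α ≠ 0 := by
  obtain ⟨A, _, _, _, τ, hτ, rfl⟩ := (isIrrChar_iff α).1 hα
  have hA : Nontrivial A := by
    by_contra hA
    rw [not_nontrivial_iff_subsingleton] at hA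
    exact bot_ne_top (α := Subrepresentation τ) (Subrepresentation.toSubmodule_injective
      (Submodule.ext fun v => by simp [Subsingleton.elim v 0]))
  refine τ.exists_isIrreducible_above (W := Representation.coindV K.subtype τ)
    (Representation.coind K.subtype τ)
    (LinearMap.proj 1 ∘ₗ (Representation.coindV K.subtype τ).subtype) (fun k f => ?_)
    (fun f hf => Subtype.ext (funext fun x => ?_)) (Representation.coind_subtype_apply_ne_one τ hc)
  · change f.1 (1 * (k : Γ)) = τ k (f.1 1)
    have h : f.1 (k * 1) = τ k (f.1 1) := f.2 k 1
    rw [← h, one_mul, mul_one]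
  · have h : f.1 (1 * x) = 0 := hf x
    rwa [one_mul] at h

end Coinduction

section PermFinThree

open Equiv

theorem sum_perm_fin_three {f : Perm (Fin 3) → ℂ} {s r : ℂ}
    (hs : ∀ g, Perm.sign g = -1 → f g = s) (hr : ∀ g ≠ 1, Perm.sign g = 1 → f g = r) :
    ∑ g, f g = f 1 + 3 * s + 2 * r := by
  have h1 : (Finset.univ : Finset (Perm (Fin 3))) = {1} ∪ Finset.univ.filter (Perm.sign · = -1) ∪
      Finset.univ.filter fun g => g ≠ 1 ∧ Perm.sign g = 1 := by decide
  rw [h1, Finset.sum_union (by decide), Finset.sum_union (by decide), Finset.sum_singleton,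
    Finset.sum_congr rfl fun g hg => hs g (Finset.mem_filter.1 hg).2,
    Finset.sum_congr rfl fun g hg => hr g (Finset.mem_filter.1 hg).2.1 (Finset.mem_filter.1 hg).2.2,
    Finset.sum_const, Finset.sum_const]
  have h2 : (Finset.univ.filter fun g : Perm (Fin 3) => Perm.sign g = -1).card = 3 := by decide
  have h3 : (Finset.univ.filter fun g : Perm (Fin 3) => g ≠ 1 ∧ Perm.sign g = 1).card = 2 := by
    decide
  rw [h2, h3]
  simp

/-- The sign character of a symmetric group, as a complex-valued homomorphism. -/
def complexSign (X : Type) [Fintype X] [DecidableEq X] : Perm X →* ℂ :=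
  ((Int.castRingHom ℂ : ℤ →* ℂ).comp (Units.coeHom ℤ)).comp Perm.sign

theorem complexSign_apply (X : Type) [Fintype X] [DecidableEq X] (g : Perm X) :
    complexSign X g = ((Perm.sign g : ℤ) : ℂ) := rfl

variable {V : Type} [AddCommGroup V] [Module ℂ V] [FiniteDimensional ℂ V]

/-- The character of a representation of `S₃` with a `3`-cycle acting nontrivially; here `x`, `y`
are the multiplicities of the linear characters, and `w` is the dimension of the remaining part. -/
theorem exists_character_perm_fin_three (ρ : Representation ℂ (Perm (Fin 3)) V)
    (hρ : ρ (finRotate 3) ≠ 1) : ∃ x y w : ℕ, 0 < w ∧ ρ.character 1 = x + y + w ∧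
      (∀ g, Perm.sign g = -1 → ρ.character g = x - y) ∧
      ∀ g ≠ 1, Perm.sign g = 1 → ρ.character g = x + y - w / 2 := by
  have hs : ∀ g, Perm.sign g = -1 → ρ.character g = ρ.character (swap 0 1) := fun g hg => by
    have h : ∀ g : Perm (Fin 3), Perm.sign g = -1 → ∃ h, h * swap 0 1 * h⁻¹ = g := by decide
    obtain ⟨h, rfl⟩ := h g hg
    exact ρ.char_conj _ _
  have hr : ∀ g ≠ 1, Perm.sign g = 1 → ρ.character g = ρ.character (finRotate 3) :=
    fun g hg hg' => by
      have h : ∀ g : Perm (Fin 3), g ≠ 1 → Perm.sign g = 1 → ∃ h, h * finRotate 3 * h⁻¹ = g := by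
        decide
      obtain ⟨h, rfl⟩ := h g hg hg'
      exact ρ.char_conj _ _
  have hcard : (Nat.card (Perm (Fin 3)) : ℂ) = 6 := by
    rw [Nat.card_eq_fintype_card, Fintype.card_perm]; norm_num [Nat.factorial]
  have hrep : IsRepChar (Perm (Fin 3)) ρ.character := ⟨V, _, _, ‹_›, ρ, rfl⟩
  obtain ⟨x, hx⟩ := hrep.exists_charInner_eq_natCast
    (isIrrChar_monoidHom (1 : Perm (Fin 3) →* ℂ)).isRepChar
  obtain ⟨y, hy⟩ := hrep.exists_charInner_eq_natCast
    (isIrrChar_monoidHom (complexSign (Fin 3))).isRepChar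
  rw [charInner, finsum_eq_sum_of_fintype, sum_perm_fin_three
    (s := ρ.character (swap 0 1)) (r := ρ.character (finRotate 3)) (fun g hg => by simp [hs g hg])
    (fun g hg hg' => by simp [hr g hg hg']), hcard] at hx
  rw [charInner, finsum_eq_sum_of_fintype, sum_perm_fin_three
    (s := -ρ.character (swap 0 1)) (r := ρ.character (finRotate 3))
    (fun g hg => by simp [hs g hg, hg, complexSign_apply])
    (fun g hg hg' => by simp [hr g hg hg', hg', complexSign_apply]), hcard] at hy
  simp only [map_one, mul_one] at hx hy
  have hm : ∃ m < Module.finrank ℂ V, ρ.character 1 + 2 * ρ.character (finRotate 3) = 3 * m := by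
    let σ : Representation ℂ (alternatingGroup (Fin 3)) V :=
      MonoidHom.comp ρ (alternatingGroup (Fin 3)).subtype
    refine ⟨Module.finrank ℂ σ.invariants, Submodule.finrank_lt fun htop => hρ ?_, ?_⟩
    · refine LinearMap.ext fun v => ?_
      have hv : v ∈ σ.invariants := htop ▸ Submodule.mem_top
      exact hv ⟨finRotate 3, Perm.mem_alternatingGroup.2 (by decide)⟩
    · have : Invertible (Nat.card (alternatingGroup (Fin 3)) : ℂ) :=
        invertibleOfNonzero (NeZero.ne _)
      have h := Representation.card_inv_mul_sum_char_eq_finrank σ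
      have hA : Nat.card (alternatingGroup (Fin 3)) = 3 := by
        rw [nat_card_alternatingGroup, Nat.card_fin]
        rfl
      have hsum : ∑ g : alternatingGroup (Fin 3), σ.character g =
          ∑ g, if Perm.sign g = 1 then ρ.character g else 0 := by
        rw [← Finset.sum_filter]
        exact (Finset.sum_subtype _ (by simp [Perm.mem_alternatingGroup]) ρ.character).symm
      rw [hsum, sum_perm_fin_three (s := 0) (r := ρ.character (finRotate 3))
        (fun g hg => by simp [hg]) (fun g hg hg' => by simp [hg', hr g hg hg']), hA] at h
      simp only [map_one, if_true] at h
      linear_combination 3 * h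
  obtain ⟨m, hmd, hm⟩ := hm
  have hxy : x + y = m := by
    have : ((x + y : ℕ) : ℂ) = m := by push_cast; linear_combination (1 / 3) * hm - hx - hy
    exact_mod_cast this
  subst hxy
  obtain ⟨w, hw⟩ := Nat.exists_eq_add_of_lt hmd
  have hd : ρ.character 1 = x + y + (w + 1 : ℕ) := by
    rw [ρ.char_one, hw]
    push_cast
    ring
  refine ⟨x, y, w + 1, w.succ_pos, hd, fun g hg => ?_, fun g hg hg' => ?_⟩
  · rw [hs g hg]
    linear_combination hx - hy
  · rw [hr g hg hg']
    push_cast at hm hd ⊢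
    linear_combination (1 / 2) * hm - (1 / 2) * hd

/-- Two representations of `S₃` on which the `3`-cycles act nontrivially both contain the
two-dimensional irreducible representation. -/
theorem charInner_perm_fin_three_ne_zero {W : Type} [AddCommGroup W] [Module ℂ W]
    [FiniteDimensional ℂ W] (ρ : Representation ℂ (Perm (Fin 3)) V)
    (σ : Representation ℂ (Perm (Fin 3)) W) (hρ : ρ (finRotate 3) ≠ 1)
    (hσ : σ (finRotate 3) ≠ 1) : charInner (Perm (Fin 3)) ρ.character σ.character ≠ 0 := by
  obtain ⟨x, y, w, hw, h1, hs, hr⟩ := exists_character_perm_fin_three ρ hρ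
  obtain ⟨x', y', w', hw', h1', hs', hr'⟩ := exists_character_perm_fin_three σ hσ
  have hcard : (Nat.card (Perm (Fin 3)) : ℂ) = 6 := by
    rw [Nat.card_eq_fintype_card, Fintype.card_perm]; norm_num [Nat.factorial]
  have key : 4 * charInner (Perm (Fin 3)) ρ.character σ.character =
      (4 * (x * x' + y * y') + w * w' : ℕ) := by
    rw [charInner, finsum_eq_sum_of_fintype, sum_perm_fin_three
      (s := (x - y) * (x' - y')) (r := (x + y - w / 2) * (x' + y' - w' / 2))
      (fun g hg => by rw [hs g hg, hs' g hg]; simp)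
      (fun g hg hg' => by rw [hr g hg hg', hr' g hg hg']; simp [map_ofNat]), hcard, h1, h1']
    simp
    ring
  intro h0
  rw [h0, mul_zero] at key
  have := Nat.mul_pos hw hw'
  have h2 : 4 * (x * x' + y * y') + w * w' = 0 := by exact_mod_cast key.symm
  omega

end PermFinThree

section Paths

variable {Γ : Type} [Group Γ] {K : Subgroup Γ} {α β γ : K → ℂ}

theorem Linked.linkedPathLE (h : Linked K α β) (hα : IsIrrChar K α) (hβ : IsIrrChar K β) :
    LinkedPathLE K 1 α β := by
  refine ⟨1, le_rfl, fun i => if i = 0 then α else β, by simp, by simp, fun i _ => ?_,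
    fun i hi => ?_⟩
  · dsimp only
    split_ifs
    exacts [hα, hβ]
  · obtain rfl : i = 0 := by omega
    simpa using h

theorem LinkedPathLE.snoc {m : ℕ} (h : LinkedPathLE K m α γ) (h' : Linked K γ β)
    (hβ : IsIrrChar K β) : LinkedPathLE K (m + 1) α β := by
  obtain ⟨k, hk, f, h0, hfk, hirr, hlink⟩ := h
  refine ⟨k + 1, by omega, fun i => if i ≤ k then f i else β, by simp [h0], by simp, fun i _ => ?_,
    fun i hi => ?_⟩
  · dsimp only
    split_ifs with h
    exacts [hirr i h, hβ]
  · rcases (Nat.lt_succ_iff.1 hi).lt_or_eq with hlt | rfl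
    · have h1 : i + 1 ≤ k := hlt
      simpa [hlt.le, h1] using hlink i hlt
    · simpa [hfk] using h'

variable {X : Type} [MulAction Γ X] [Finite Γ] [Finite X] [MulAction.IsPretransitive Γ X] {x : X}

omit [Finite Γ] [MulAction.IsPretransitive Γ X] in
variable (Γ X) in
theorem isRepChar_permChar_pow (k : ℕ) : IsRepChar Γ (permChar Γ X ^ k) := by
  rw [← permChar_fin_fun]
  exact isRepChar_permChar Γ _

/-- Powers of the permutation character bound distances in the Külshammer graph from above. -/
theorem linkedPathLE_of_charInner_ne_zero {χ ψ : Γ → ℂ} (hχ : IsIrrChar Γ χ)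
    (hψ : IsIrrChar Γ ψ) (k : ℕ) (h : charInner Γ (χ * permChar Γ X ^ k) ψ ≠ 0)
    {α β : MulAction.stabilizer Γ x → ℂ} (hα : IsIrrChar _ α) (hβ : IsIrrChar _ β)
    (hχα : charInner _ (resChar (MulAction.stabilizer Γ x) χ) α ≠ 0)
    (hψβ : charInner _ (resChar (MulAction.stabilizer Γ x) ψ) β ≠ 0) :
    LinkedPathLE (MulAction.stabilizer Γ x) (k + 1) α β := by
  induction k generalizing ψ β with
  | zero =>
    rw [pow_zero, mul_one] at h
    refine Linked.linkedPathLE ⟨ψ, hψ, ?_, hψβ⟩ hα hβ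
    exact hψ.isRepChar.charInner_comp_ne_zero hχ (charInner_ne_zero_symm h)
      (MulAction.stabilizer Γ x).subtype hα.isRepChar hχα
  | succ k ih =>
    have hmove : charInner Γ (χ * permChar Γ X ^ (k + 1)) ψ =
        charInner Γ (χ * permChar Γ X ^ k) (ψ * permChar Γ X) := by
      simp only [charInner, Pi.mul_apply, Pi.pow_apply, permChar, map_mul, map_natCast, pow_succ,
        mul_assoc, mul_comm, mul_left_comm]
    rw [hmove] at h
    obtain ⟨χ', hχ', h1, h2⟩ := (hχ.isRepChar.mul (isRepChar_permChar_pow Γ X k)).exists_isIrrChar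
      (hψ.isRepChar.mul (isRepChar_permChar Γ X)) h
    rw [hψ.isRepChar.charInner_mul_permChar_ne_zero_iff_of_isPretransitive hχ'.isRepChar x] at h2
    obtain ⟨γ, hγ, h3, h4⟩ := (hψ.isRepChar.restrict _).exists_isIrrChar
      (hχ'.isRepChar.restrict _) h2
    exact (ih hχ' h1 hγ h4).snoc ⟨ψ, hψ, h3, hψβ⟩ hβ

/-- Characters at distance at most `k` from the trivial character are constituents of the `k`-th
power of the permutation character. -/
theorem LinkedPathLE.exists_charInner_permChar_pow_ne_zero {m : ℕ}
    {β : MulAction.stabilizer Γ x → ℂ}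
    (h : LinkedPathLE (MulAction.stabilizer Γ x) m (1 : _ →* ℂ) β) :
    ∃ k ≤ m, charInner _ (resChar (MulAction.stabilizer Γ x) (permChar Γ X ^ k)) β ≠ 0 := by
  obtain ⟨k, hk, f, h0, rfl, hirr, hlink⟩ := h
  refine ⟨k, hk, ?_⟩
  have key : ∀ i ≤ k,
      charInner _ (resChar (MulAction.stabilizer Γ x) (permChar Γ X ^ i)) (f i) ≠ 0 := by
    intro i hi
    induction i with
    | zero =>
      have := Fintype.ofFinite (MulAction.stabilizer Γ x)
      simp only [h0, charInner, resChar, finsum_eq_sum_of_fintype, pow_zero, Pi.one_apply,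
        MonoidHom.one_apply, map_one, mul_one, Finset.sum_const, Finset.card_univ, nsmul_eq_mul,
        ← Nat.card_eq_fintype_card]
      rw [inv_mul_cancel₀ (NeZero.ne _)]
      exact one_ne_zero
    | succ i ih =>
      obtain ⟨χ, hχ, h1, h2⟩ := hlink i hi
      have hπ := isRepChar_permChar_pow Γ X
      have h3 := ((hπ i).restrict (MulAction.stabilizer Γ x)).charInner_ne_zero_of_common
        (hχ.isRepChar.restrict _) (hirr i (by omega)) (ih (by omega)) h1
      rw [← (hπ i).charInner_mul_permChar_ne_zero_iff_of_isPretransitive hχ.isRepChar x,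
        ← pow_succ] at h3
      exact (hπ (i + 1)).charInner_comp_ne_zero hχ h3 (MulAction.stabilizer Γ x).subtype
        (hirr (i + 1) hi).isRepChar h2
  exact key k le_rfl

end Paths

section SymmetricGroup

open Equiv

/-- A power of the natural permutation character of `Sₙ` with exponent at most `n - 2` does not
contain the sign character. -/
theorem charInner_permChar_pow_complexSign {n k : ℕ} (hk : k + 2 ≤ n) :
    charInner (Perm (Fin n)) (permChar (Perm (Fin n)) (Fin n) ^ k) (complexSign (Fin n)) = 0 := by
  classical
  by_contra h
  rw [← permChar_fin_fun, ← one_mul (permChar _ _)] at h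
  obtain ⟨t, ht⟩ := ((isIrrChar_monoidHom (1 : Perm (Fin n) →* ℂ)).isRepChar
    |>.charInner_mul_permChar_ne_zero_iff (isIrrChar_monoidHom (complexSign (Fin n))).isRepChar).1 h
  have hcard : 1 < ((Finset.univ.image t)ᶜ).card := by
    have := Finset.card_image_le (s := Finset.univ) (f := t)
    rw [Finset.card_compl]
    simp only [Finset.card_univ, Fintype.card_fin] at this ⊢
    omega
  obtain ⟨b, hb, c, hc, hbc⟩ := Finset.one_lt_card.1 hcard
  simp only [Finset.mem_compl, Finset.mem_image, Finset.mem_univ, true_and, not_exists] at hb hc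
  have hswap : swap b c ∈ MulAction.stabilizer (Perm (Fin n)) t :=
    funext fun i => swap_apply_of_ne_of_ne (hb i) (hc i)
  let l := (complexSign (Fin n)).comp (MulAction.stabilizer (Perm (Fin n)) t).subtype
  have hl : l ≠ 1 := fun h1 => by
    have h2 : complexSign (Fin n) (swap b c) = 1 := DFunLike.congr_fun h1 ⟨_, hswap⟩
    norm_num [complexSign_apply, Perm.sign_swap hbc] at h2
  refine charInner_ne_zero_symm ht ?_
  have := Fintype.ofFinite (MulAction.stabilizer (Perm (Fin n)) t)
  have hsum := sum_hom_units_eq_zero l hl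
  rw [charInner, finsum_eq_sum_of_fintype]
  refine mul_eq_zero_of_right _ (Eq.trans (Finset.sum_congr rfl fun g _ => ?_) hsum)
  simp [resChar, l]

/-- If the tuple `t` enumerates the complement of the range of `e`, then the permutations fixing
`t` are those induced from the domain of `e`. -/
theorem exists_viaEmbedding_eq {X Y ι : Type} (e : Y ↪ X) (t : ι → X)
    (ht : Set.range t = (Set.range e)ᶜ) {g : Perm X} (hg : g ∈ MulAction.stabilizer (Perm X) t) :
    ∃ s : Perm Y, s.viaEmbedding e = g := by
  have hfix : ∀ x, x ∉ Set.range e → g x = x := fun x hx => by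
    obtain ⟨i, rfl⟩ : x ∈ Set.range t := ht ▸ hx
    exact congrFun hg i
  have hmem : ∀ x, g x ∈ Set.range e ↔ x ∈ Set.range e := fun x => by
    refine not_iff_not.1 ⟨fun h => ?_, fun h => (hfix x h).symm ▸ h⟩
    rwa [g.injective (hfix _ h)] at h
  let r := Equiv.ofInjective e e.injective
  refine ⟨r.symm.permCongr (g.subtypePerm hmem), Equiv.ext fun x => ?_⟩
  by_cases hx : x ∈ Set.range e
  · obtain ⟨y, rfl⟩ := hx
    rw [Perm.viaEmbedding_apply]
    exact Equiv.apply_ofInjective_symm e.injective _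
  · rw [Perm.viaEmbedding_apply_of_notMem _ _ _ hx, hfix x hx]

theorem charInner_mul_permChar_pow_ne_zero {n : ℕ} (e : Fin 3 ↪ Fin n)
    {V W : Type} [AddCommGroup V] [Module ℂ V] [FiniteDimensional ℂ V] [AddCommGroup W]
    [Module ℂ W] [FiniteDimensional ℂ W] (ρ : Representation ℂ (Perm (Fin n)) V)
    (σ : Representation ℂ (Perm (Fin n)) W) (hρ : ρ ((finRotate 3).viaEmbedding e) ≠ 1)
    (hσ : σ ((finRotate 3).viaEmbedding e) ≠ 1) :
    charInner (Perm (Fin n)) (ρ.character * permChar (Perm (Fin n)) (Fin n) ^ (n - 3))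
      σ.character ≠ 0 := by
  classical
  have hcard : ((Finset.univ.map e)ᶜ).card = n - 3 := by simp [Finset.card_compl]
  let t : Fin (n - 3) → Fin n := ((Finset.univ.map e)ᶜ).orderEmbOfFin hcard
  have ht : Set.range t = (Set.range e)ᶜ := by simp [t, Finset.range_orderEmbOfFin]
  have hρ' : IsRepChar (Perm (Fin n)) ρ.character := ⟨V, _, _, ‹_›, ρ, rfl⟩
  have hσ' : IsRepChar (Perm (Fin n)) σ.character := ⟨W, _, _, ‹_›, σ, rfl⟩
  rw [← permChar_fin_fun, hρ'.charInner_mul_permChar_ne_zero_iff hσ']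
  refine ⟨t, ?_⟩
  let f : Perm (Fin 3) →* MulAction.stabilizer (Perm (Fin n)) t :=
    (Perm.viaEmbeddingHom e).codRestrict _ fun s => funext fun i =>
      Perm.viaEmbedding_apply_of_notMem _ _ _ (ht ▸ Set.mem_range_self i : t i ∈ (Set.range e)ᶜ)
  refine (hρ'.restrict _).charInner_ne_zero_of_comp_surjective (hσ'.restrict _) f ?_ ?_
  · rintro ⟨g, hg⟩
    obtain ⟨s, hs⟩ := exists_viaEmbedding_eq e t ht hg
    exact ⟨s, Subtype.ext hs⟩
  · exact charInner_perm_fin_three_ne_zero (MonoidHom.comp ρ (Perm.viaEmbeddingHom e))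
      (MonoidHom.comp σ (Perm.viaEmbeddingHom e)) hρ hσ

end SymmetricGroup

/-- Let `n ≥ 3`, `G = Sₙ`, and let `H ≅ S_{n-1}` be the stabilizer of a
letter. Then the Külshammer graph `K(G,H)` has diameter exactly `n - 2` (equivalently,
`d_G(H) = 2n - 3`, the maximal depth of a subgroup of `Sₙ`). -/
theorem kulshammer_point_stabilizer (n : ℕ) (hn : 3 ≤ n) (a : Fin n)
    (H : Subgroup (Equiv.Perm (Fin n)))
    (hH : H = MulAction.stabilizer (Equiv.Perm (Fin n)) a) :
    (∀ α β : ↥H → ℂ, IsIrrChar ↥H α → IsIrrChar ↥H β → LinkedPathLE H (n - 2) α β) ∧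
    (∃ α β : ↥H → ℂ, IsIrrChar ↥H α ∧ IsIrrChar ↥H β ∧ ¬ LinkedPathLE H (n - 3) α β) := by
  subst hH
  constructor
  · intro α β hα hβ
    let e : Fin 3 ↪ Fin n :=
      (Fin.castLEEmb hn).trans (Equiv.swap (Fin.castLE hn 0) a).toEmbedding
    have he : e 0 = a := Equiv.swap_apply_left (Fin.castLE hn 0) a
    have hc : (finRotate 3).viaEmbedding e ∉ MulAction.stabilizer (Equiv.Perm (Fin n)) a := by
      intro h
      have h1 : (finRotate 3).viaEmbedding e (e 0) = e 0 := by rw [he]; exact h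
      rw [Equiv.Perm.viaEmbedding_apply] at h1
      exact absurd (e.injective h1) (by decide)
    obtain ⟨V, _, _, _, ρ, hρ, hρc, hρα⟩ := hα.exists_isIrreducible_apply_ne_one hc
    obtain ⟨W, _, _, _, σ, hσ, hσc, hσβ⟩ := hβ.exists_isIrreducible_apply_ne_one hc
    have h := linkedPathLE_of_charInner_ne_zero
      ((isIrrChar_iff _).2 ⟨V, _, _, ‹_›, ρ, hρ, rfl⟩)
      ((isIrrChar_iff _).2 ⟨W, _, _, ‹_›, σ, hσ, rfl⟩) (n - 3)
      (charInner_mul_permChar_pow_ne_zero e ρ σ hρc hσc) hα hβ hρα hσβ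
    rwa [show n - 3 + 1 = n - 2 by omega] at h
  · refine ⟨(1 : _ →* ℂ), (complexSign (Fin n)).comp (MulAction.stabilizer _ a).subtype,
      isIrrChar_monoidHom _, isIrrChar_monoidHom _, fun h => ?_⟩
    obtain ⟨k, hk, h1⟩ := h.exists_charInner_permChar_pow_ne_zero
    have h2 := ((isRepChar_permChar_pow (Equiv.Perm (Fin n)) (Fin n) k)
      |>.charInner_mul_permChar_ne_zero_iff_of_isPretransitive
        (isIrrChar_monoidHom (complexSign (Fin n))).isRepChar a).2 h1
    rw [← pow_succ] at h2
    exact h2 (charInner_permChar_pow_complexSign (by omega))
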